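/- Let $r,r'$ be roots with $\langle r,r'\rangle\ne 0$ and $r'\ne\pm r$ (an azygetic pair). Then the composition $s_r\circ s_{r'}$ permutes the set $L$ of $27$ exceptional vectors, has order $3$ as a permutation of $L$, and has exactly $9$ fixed points in $L$; equivalently, its cycle type on $L$ is $(3^6,1^9)$, a product of six disjoint $3$-cycles. -/

import Mathlib

/-- The symmetric bilinear form on `ℤ^{1,6}`: `⟨x,y⟩ = x₀y₀ - ∑_{i=1}^{6} xᵢyᵢ`. -/
def form (x y : Fin 7 → ℤ) : ℤ := 2 * (x 0 * y 0) - ∑ i, x i * y i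

/-- The standard basis vector `f i` of `V = ℤ⁷`. -/
def fvec (i : Fin 7) : Fin 7 → ℤ := fun j => if j = i then 1 else 0

/-- The canonical vector `k = -3f₀ + f₁ + ⋯ + f₆`. -/
def kvec : Fin 7 → ℤ := fun i => if i = 0 then -3 else 1

/-- A root of the `E₆` lattice: a vector `r` with `⟨r,k⟩ = 0` and `⟨r,r⟩ = -2`. -/
def IsRoot (r : Fin 7 → ℤ) : Prop := form r kvec = 0 ∧ form r r = -2

/-- An exceptional vector: a vector `ℓ` with `⟨ℓ,ℓ⟩ = -1` and `⟨ℓ,k⟩ = -1`. -/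
def IsExc (l : Fin 7 → ℤ) : Prop := form l l = -1 ∧ form l kvec = -1

/-- The reflection in a root `r`, as a plain function: `x ↦ x + ⟨x,r⟩ r`. -/
def reflFun (r : Fin 7 → ℤ) (x : Fin 7 → ℤ) : Fin 7 → ℤ := x + form x r • r

/-- The list of the 27 exceptional vectors. -/
def excList : List (Fin 7 → ℤ) :=
  [![0, 1, 0, 0, 0, 0, 0],
   ![0, 0, 1, 0, 0, 0, 0],
   ![0, 0, 0, 1, 0, 0, 0],
   ![0, 0, 0, 0, 1, 0, 0],
   ![0, 0, 0, 0, 0, 1, 0],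
   ![0, 0, 0, 0, 0, 0, 1],
   ![1, -1, -1, 0, 0, 0, 0],
   ![1, -1, 0, -1, 0, 0, 0],
   ![1, -1, 0, 0, -1, 0, 0],
   ![1, -1, 0, 0, 0, -1, 0],
   ![1, -1, 0, 0, 0, 0, -1],
   ![1, 0, -1, -1, 0, 0, 0],
   ![1, 0, -1, 0, -1, 0, 0],
   ![1, 0, -1, 0, 0, -1, 0],
   ![1, 0, -1, 0, 0, 0, -1],
   ![1, 0, 0, -1, -1, 0, 0],
   ![1, 0, 0, -1, 0, -1, 0],
   ![1, 0, 0, -1, 0, 0, -1],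
   ![1, 0, 0, 0, -1, -1, 0],
   ![1, 0, 0, 0, -1, 0, -1],
   ![1, 0, 0, 0, 0, -1, -1],
   ![2, 0, -1, -1, -1, -1, -1],
   ![2, -1, 0, -1, -1, -1, -1],
   ![2, -1, -1, 0, -1, -1, -1],
   ![2, -1, -1, -1, 0, -1, -1],
   ![2, -1, -1, -1, -1, 0, -1],
   ![2, -1, -1, -1, -1, -1, 0]]

lemma form_expand (x y : Fin 7 → ℤ) : form x y = x 0 * y 0 - x 1 * y 1 - x 2 * y 2 - x 3 * y 3
    - x 4 * y 4 - x 5 * y 5 - x 6 * y 6 := by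
  simp only [form, Fin.sum_univ_seven]; ring

lemma form_k (x : Fin 7 → ℤ) : form x kvec = -3 * x 0 - x 1 - x 2 - x 3 - x 4 - x 5 - x 6 := by
  rw [form_expand]; simp [kvec]; ring

lemma form_comm (x y : Fin 7 → ℤ) : form x y = form y x := by
  simp only [form_expand]; ring

lemma form_add_left (x y z : Fin 7 → ℤ) : form (x + y) z = form x z + form y z := by
  simp only [form_expand, Pi.add_apply]; ring

lemma form_smul_left (c : ℤ) (x z : Fin 7 → ℤ) : form (c • x) z = c * form x z := by
  simp only [form_expand, Pi.smul_apply, smul_eq_mul]; ring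

lemma form_add_right (x y z : Fin 7 → ℤ) : form z (x + y) = form z x + form z y := by
  simp only [form_expand, Pi.add_apply]; ring

lemma form_smul_right (c : ℤ) (x z : Fin 7 → ℤ) : form z (c • x) = c * form z x := by
  simp only [form_expand, Pi.smul_apply, smul_eq_mul]; ring

lemma excList_nodup : excList.Nodup := by decide +kernel

lemma excList_sum (x y : Fin 7 → ℤ) :
    (excList.map (fun l => form l x * form l y)).sum
      = -6 * form x y + 5 * (form x kvec * form y kvec) := by
  rw [form_k x, form_k y]
  simp only [form_expand, excList, List.map_cons, List.map_nil, List.sum_cons, List.sum_nil]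
  simp
  ring

lemma cs6 (a b c d e f : ℤ) : (a + b + c + d + e + f)^2 ≤
    6 * (a * a + b * b + c * c + d * d + e * e + f * f) := by
  nlinarith [sq_nonneg (a - b), sq_nonneg (a - c), sq_nonneg (a - d), sq_nonneg (a - e),
    sq_nonneg (a - f), sq_nonneg (b - c), sq_nonneg (b - d), sq_nonneg (b - e), sq_nonneg (b - f),
    sq_nonneg (c - d), sq_nonneg (c - e), sq_nonneg (c - f), sq_nonneg (d - e), sq_nonneg (d - f),
    sq_nonneg (e - f)]

lemma prod_nonneg (x s : ℤ) (hs : s = 1 ∨ s = -1) : 0 ≤ x * (x - s) := by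
  rcases hs with rfl | rfl
  · rcases le_or_gt x 0 with h | h <;> nlinarith
  · rcases le_or_gt 0 x with h | h <;> nlinarith

lemma zero_or (x s : ℤ) (h : x * (x - s) = 0) : x = 0 ∨ x = s := by
  rcases mul_eq_zero.1 h with h | h
  · exact Or.inl h
  · exact Or.inr (by linarith)

lemma neg_def (v : Fin 7 → ℤ) (hk : form v kvec = 0) : form v v ≤ 0 := by
  rw [form_k] at hk
  rw [form_expand]
  have h : 3 * v 0 = - (v 1 + v 2 + v 3 + v 4 + v 5 + v 6) := by linarith
  have h2 : 9 * (v 0 * v 0) = (v 1 + v 2 + v 3 + v 4 + v 5 + v 6)^2 := by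
    linear_combination (3 * v 0 - (v 1 + v 2 + v 3 + v 4 + v 5 + v 6)) * h
  have := cs6 (v 1) (v 2) (v 3) (v 4) (v 5) (v 6)
  nlinarith [sq_nonneg (v 0), sq_nonneg (v 1), sq_nonneg (v 2), sq_nonneg (v 3), sq_nonneg (v 4), sq_nonneg (v 5), sq_nonneg (v 6)]

lemma neg_def_eq (v : Fin 7 → ℤ) (hk : form v kvec = 0) (h0 : 0 ≤ form v v) : v = 0 := by
  rw [form_k] at hk
  rw [form_expand] at h0
  have h : 3 * v 0 = - (v 1 + v 2 + v 3 + v 4 + v 5 + v 6) := by linarith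
  have h2 : 9 * (v 0 * v 0) = (v 1 + v 2 + v 3 + v 4 + v 5 + v 6)^2 := by
    linear_combination (3 * v 0 - (v 1 + v 2 + v 3 + v 4 + v 5 + v 6)) * h
  have h3 := cs6 (v 1) (v 2) (v 3) (v 4) (v 5) (v 6)
  have e0 := sq_nonneg (v 0)
  have e1 := sq_nonneg (v 1)
  have e2 := sq_nonneg (v 2)
  have e3 := sq_nonneg (v 3)
  have e4 := sq_nonneg (v 4)
  have e5 := sq_nonneg (v 5)
  have e6 := sq_nonneg (v 6)
  have z0 : v 0 ^ 2 ≤ 0 := by linarith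
  have hz : v 1 ^ 2 + v 2 ^ 2 + v 3 ^ 2 + v 4 ^ 2 + v 5 ^ 2 + v 6 ^ 2 ≤ 0 := by linarith
  have hi : ∀ i, v i ^ 2 ≤ 0 := by
    intro i
    fin_cases i <;> simp only [Fin.zero_eta, Fin.mk_one, Fin.reduceFinMk] <;> linarith
  funext i
  exact pow_eq_zero_iff two_ne_zero |>.1 (le_antisymm (hi i) (sq_nonneg _))

lemma isExc_iff (l : Fin 7 → ℤ) : IsExc l ↔ l ∈ excList := by
  constructor
  · rintro ⟨h1, h2⟩
    rw [form_k] at h2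
    rw [form_expand] at h1
    have h3 := cs6 (l 1) (l 2) (l 3) (l 4) (l 5) (l 6)
    have h4 : (l 1 + l 2 + l 3 + l 4 + l 5 + l 6)^2 = (1 - 3 * l 0)^2 := by
      congr 1; linarith
    have hlo : 0 ≤ l 0 := by nlinarith
    have hhi : l 0 ≤ 2 := by nlinarith
    have key : ∃ s : ℤ, (s = 1 ∧ l 0 = 0 ∨ s = -1 ∧ l 0 = 1 ∨ s = -1 ∧ l 0 = 2) ∧
        l 1 * (l 1 - s) + l 2 * (l 2 - s) + l 3 * (l 3 - s) + l 4 * (l 4 - s) + l 5 * (l 5 - s)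
          + l 6 * (l 6 - s) = 0 := by
      have : l 0 = 0 ∨ l 0 = 1 ∨ l 0 = 2 := by omega
      rcases this with h | h | h
      · exact ⟨1, by simp [h], by rw [h] at h1 h2; linarith⟩
      · exact ⟨-1, by simp [h], by rw [h] at h1 h2; linarith⟩
      · exact ⟨-1, by simp [h], by rw [h] at h1 h2; linarith⟩
    obtain ⟨s, hs, hz⟩ := key
    have hs1 : s = 1 ∨ s = -1 := by omega
    have n1 := prod_nonneg (l 1) s hs1
    have n2 := prod_nonneg (l 2) s hs1
    have n3 := prod_nonneg (l 3) s hs1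
    have n4 := prod_nonneg (l 4) s hs1
    have n5 := prod_nonneg (l 5) s hs1
    have n6 := prod_nonneg (l 6) s hs1
    have z1 := zero_or (l 1) s (by linarith)
    have z2 := zero_or (l 2) s (by linarith)
    have z3 := zero_or (l 3) s (by linarith)
    have z4 := zero_or (l 4) s (by linarith)
    have z5 := zero_or (l 5) s (by linarith)
    have z6 := zero_or (l 6) s (by linarith)
    have hl : l = ![l 0, l 1, l 2, l 3, l 4, l 5, l 6] := by
      funext i; fin_cases i <;> rfl
    clear h1 h3 h4 n1 n2 n3 n4 n5 n6 hz hs1 hlo hhi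
    rw [hl]
    generalize l 0 = a0 at *
    generalize l 1 = a1 at *
    generalize l 2 = a2 at *
    generalize l 3 = a3 at *
    generalize l 4 = a4 at *
    generalize l 5 = a5 at *
    generalize l 6 = a6 at *
    clear hl
    rcases hs with ⟨rfl, rfl⟩ | ⟨rfl, rfl⟩ | ⟨rfl, rfl⟩ <;>
    rcases z1 with rfl | rfl <;> rcases z2 with rfl | rfl <;> rcases z3 with rfl | rfl <;>
    rcases z4 with rfl | rfl <;> rcases z5 with rfl | rfl <;> rcases z6 with rfl | rfl <;>
    first
      | (exfalso; omega)
      | decide +kernel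
  · intro h
    have : ∀ l ∈ excList, form l l = -1 ∧ form l kvec = -1 := by decide +kernel
    exact this l h

/-- Root times line is in `{-1,0,1}`. -/
lemma root_exc (l r : Fin 7 → ℤ) (hl : IsExc l) (hr : IsRoot r) :
    -1 ≤ form l r ∧ form l r ≤ 1 := by
  obtain ⟨h1, h2⟩ := hl
  obtain ⟨h3, h4⟩ := hr
  have hkk : form kvec kvec = 3 := by decide +kernel
  have c1 := form_comm kvec l
  have c2 := form_comm kvec r
  have c3 := form_comm r l
  -- `v = 2(3l+k) + 3⟨l,r⟩ r` is orthogonal to `k`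
  have hv := neg_def ((6:ℤ) • l + (2:ℤ) • kvec + (3 * form l r) • r) (by
    simp only [form_add_left, form_smul_left, h2, h3, hkk]; ring)
  simp only [form_add_left, form_smul_left, form_add_right, form_smul_right, h1, h2, h3, h4, hkk,
    c1, c2, c3] at hv
  constructor <;> nlinarith

lemma azy (r r' : Fin 7 → ℤ) (hr : IsRoot r) (hr' : IsRoot r')
    (hne : r' ≠ r ∧ r' ≠ -r) (hazy : form r r' ≠ 0) : form r r' = 1 ∨ form r r' = -1 := by
  obtain ⟨h1, h2⟩ := hr
  obtain ⟨h3, h4⟩ := hr'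
  have c := form_comm r' r
  have hlt : form r r' < 2 := by
    by_contra hc
    have := neg_def_eq (r' + r) (by rw [form_add_left, h1, h3]; rfl) (by
      simp only [form_add_left, form_add_right, h2, h4, c]; linarith)
    exact hne.2 (eq_neg_of_add_eq_zero_left this)
  have hgt : -2 < form r r' := by
    by_contra hc
    have := neg_def_eq (r' + (-1 : ℤ) • r) (by
      rw [form_add_left, form_smul_left, h1, h3]; rfl) (by
      simp only [form_add_left, form_add_right, form_smul_left, form_smul_right, h2, h4, c]; linarith)
    apply hne.1
    rw [neg_one_smul] at this
    exact eq_of_add_neg_eq_zero this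
  omega

lemma reflFun_exc (r l : Fin 7 → ℤ) (hr : IsRoot r) (hl : IsExc l) : IsExc (reflFun r l) := by
  obtain ⟨h1, h2⟩ := hr
  obtain ⟨h3, h4⟩ := hl
  have c := form_comm r l
  constructor
  · simp only [reflFun, form_add_left, form_add_right, form_smul_left, form_smul_right, h2, h3, c]
    ring
  · simp only [reflFun, form_add_left, form_smul_left, h1, h4]; ring

lemma comp_eq (r r' l : Fin 7 → ℤ) : reflFun r (reflFun r' l) =
    l + form l r' • r' + (form l r + form l r' * form r r') • r := by
  simp only [reflFun, form_add_left, form_smul_left, form_comm r' r]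

lemma comp_form_left (r r' l : Fin 7 → ℤ) (hr : IsRoot r) :
    form (reflFun r (reflFun r' l)) r = - form l r - form l r' * form r r' := by
  simp only [comp_eq, form_add_left, form_smul_left, form_comm r' r, hr.2]; ring

lemma comp_form_right (r r' l : Fin 7 → ℤ) (hr' : IsRoot r') (hf : form r r' * form r r' = 1) :
    form (reflFun r (reflFun r' l)) r' = form l r * form r r' := by
  simp only [comp_eq, form_add_left, form_smul_left, hr'.2]
  linear_combination form l r' * hf

lemma comp_cube (r r' l : Fin 7 → ℤ) (hr : IsRoot r) (hr' : IsRoot r')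
    (hf : form r r' * form r r' = 1) :
    reflFun r (reflFun r' (reflFun r (reflFun r' (reflFun r (reflFun r' l))))) = l := by
  rw [comp_eq r r' (reflFun r (reflFun r' (reflFun r (reflFun r' l))))]
  simp only [comp_form_left _ _ _ hr, comp_form_right _ _ _ hr' hf]
  rw [comp_eq r r' (reflFun r (reflFun r' l))]
  simp only [comp_form_left _ _ _ hr, comp_form_right _ _ _ hr' hf]
  rw [comp_eq]
  funext i
  simp only [Pi.add_apply, Pi.smul_apply, smul_eq_mul]
  linear_combination (-form l r * r i - form l r' * r' i - form l r' * form r r' * r i) * hf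

lemma comp_fixed_iff (r r' l : Fin 7 → ℤ) (hr : IsRoot r) (hr' : IsRoot r')
    (hf : form r r' * form r r' = 1) :
    reflFun r (reflFun r' l) = l ↔ form l r = 0 ∧ form l r' = 0 := by
  constructor
  · intro h
    have h1 := comp_form_left r r' l hr
    have h2 := comp_form_right r r' l hr' hf
    rw [h] at h1 h2
    have : form l r = 0 := by
      have : 3 * form l r = 0 := by
        linear_combination h1 - form r r' * h2 - form l r * hf
      omega
    exact ⟨this, by rw [h2, this, zero_mul]⟩
  · rintro ⟨h1, h2⟩
    simp [comp_eq, h1, h2]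

lemma prod_sq (r r' l : Fin 7 → ℤ) (hr : IsRoot r) (hr' : IsRoot r')
    (hf : form r r' = 1 ∨ form r r' = -1) (hl : IsExc l) :
    (if form l r = 0 ∧ form l r' = 0 then (1:ℤ) else 0) =
      1 - form l r * form l r - form l r' * form l r'
        - form r r' * (form l r * form l r') := by
  have c := form_comm r' r
  have hroot : IsRoot (r + form r r' • r') := by
    constructor
    · rw [form_add_left, form_smul_left, hr.1, hr'.1]; ring
    · simp only [form_add_left, form_add_right, form_smul_left, form_smul_right, hr.2, hr'.2, c]
      rcases hf with h | h <;> rw [h] <;> norm_num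
  have h1 := root_exc l r hl hr
  have h2 := root_exc l r' hl hr'
  have h3 := root_exc l _ hl hroot
  rw [form_add_right, form_smul_right] at h3
  generalize form l r = a at *
  generalize form l r' = b at *
  obtain ⟨a1, a2⟩ := h1
  obtain ⟨b1, b2⟩ := h2
  rcases hf with h | h <;> rw [h] at h3 ⊢ <;> interval_cases a <;> interval_cases b <;> simp_all

lemma fixed_count (r r' : Fin 7 → ℤ) (hr : IsRoot r) (hr' : IsRoot r')
    (hf : form r r' = 1 ∨ form r r' = -1) :
    (excList.toFinset.filter (fun l => form l r = 0 ∧ form l r' = 0)).card = 9 := by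
  have hS : ∀ x y, form x kvec = 0 →
      ∑ l ∈ excList.toFinset, form l x * form l y = -6 * form x y := by
    intro x y hx
    rw [List.sum_toFinset _ excList_nodup, excList_sum, hx]; ring
  have hcard : excList.toFinset.card = 27 := by
    rw [List.toFinset_card_of_nodup excList_nodup]; rfl
  have : ((excList.toFinset.filter (fun l => form l r = 0 ∧ form l r' = 0)).card : ℤ) = 9 := by
    rw [Finset.card_filter]
    push_cast
    rw [Finset.sum_congr rfl (fun l hl => prod_sq r r' l hr hr' hf
      ((isExc_iff l).2 (List.mem_toFinset.1 hl)))]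
    rw [Finset.sum_sub_distrib, Finset.sum_sub_distrib, Finset.sum_sub_distrib, ← Finset.mul_sum,
      hS _ _ hr.1, hS _ _ hr'.1, hS _ _ hr.1, hr.2, hr'.2, Finset.sum_const, hcard]
    rcases hf with h | h <;> rw [h] <;> norm_num
  exact_mod_cast this



/-- For an azygetic pair of roots `r, r'` (so `⟨r,r'⟩ ≠ 0`, `r' ≠ ±r`), the composition
`s_r ∘ s_{r'}` permutes the `27` exceptional vectors, has order `3` on them, and has
exactly `9` fixed points among them (so it moves `18` of them in six disjoint `3`-cycles:
cycle type `(3⁶,1⁹)`). -/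
theorem stmt_7 (r r' : Fin 7 → ℤ) (hr : IsRoot r) (hr' : IsRoot r')
    (hne : r' ≠ r ∧ r' ≠ -r) (hazy : form r r' ≠ 0) :
    Set.BijOn (fun l => reflFun r (reflFun r' l))
      {l : Fin 7 → ℤ | IsExc l} {l : Fin 7 → ℤ | IsExc l} ∧
    (∀ l : Fin 7 → ℤ, IsExc l →
      reflFun r (reflFun r' (reflFun r (reflFun r' (reflFun r (reflFun r' l))))) = l) ∧
    (∃ l : Fin 7 → ℤ, IsExc l ∧ reflFun r (reflFun r' l) ≠ l) ∧
    {l : Fin 7 → ℤ | IsExc l ∧ reflFun r (reflFun r' l) = l}.ncard = 9 ∧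
    {l : Fin 7 → ℤ | IsExc l ∧ reflFun r (reflFun r' l) ≠ l}.ncard = 18 := by
  have hf := azy r r' hr hr' hne hazy
  have hff : form r r' * form r r' = 1 := by rcases hf with h | h <;> rw [h] <;> norm_num
  have hcube : ∀ l, reflFun r (reflFun r' (reflFun r (reflFun r' (reflFun r (reflFun r' l))))) = l :=
    fun l => comp_cube r r' l hr hr' hff
  have hmaps : ∀ l, IsExc l → IsExc (reflFun r (reflFun r' l)) :=
    fun l hl => reflFun_exc r _ hr (reflFun_exc r' l hr' hl)
  have hcard : excList.toFinset.card = 27 := by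
    rw [List.toFinset_card_of_nodup excList_nodup]; rfl
  have h9 := fixed_count r r' hr hr' hf
  have hmoved : {l : Fin 7 → ℤ | IsExc l ∧ reflFun r (reflFun r' l) ≠ l}.ncard = 18 := by
    have : {l : Fin 7 → ℤ | IsExc l ∧ reflFun r (reflFun r' l) ≠ l} =
        ↑(excList.toFinset.filter (fun l => ¬ (form l r = 0 ∧ form l r' = 0))) := by
      ext l
      rw [Set.mem_ofPred_eq, Finset.mem_coe, Finset.mem_filter, List.mem_toFinset, isExc_iff, Ne,
        comp_fixed_iff r r' l hr hr' hff]
    rw [this, Set.ncard_coe_finset]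
    have := Finset.card_filter_add_card_filter_not (s := excList.toFinset)
      (fun l => form l r = 0 ∧ form l r' = 0)
    omega
  refine ⟨⟨fun l hl => hmaps l hl, ?_, ?_⟩, fun l _ => hcube l, ?_, ?_, hmoved⟩
  · intro x _ y _ hxy
    have hxy' : reflFun r (reflFun r' x) = reflFun r (reflFun r' y) := hxy
    rw [← hcube x, ← hcube y, hxy']
  · intro l hl
    exact ⟨_, hmaps _ (hmaps l hl), hcube l⟩
  · have : {l : Fin 7 → ℤ | IsExc l ∧ reflFun r (reflFun r' l) ≠ l}.Nonempty := by
      apply Set.nonempty_of_ncard_ne_zero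
      rw [hmoved]; norm_num
    exact this
  · have : {l : Fin 7 → ℤ | IsExc l ∧ reflFun r (reflFun r' l) = l} =
        ↑(excList.toFinset.filter (fun l => form l r = 0 ∧ form l r' = 0)) := by
      ext l
      rw [Set.mem_ofPred_eq, Finset.mem_coe, Finset.mem_filter, List.mem_toFinset, isExc_iff,
        comp_fixed_iff r r' l hr hr' hff]
    rw [this, Set.ncard_coe_finset, h9]
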